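/- arXiv:2206.02352 — 2 statements merged into one kernel-verified Lean document; each statement's English description precedes it below -/
import Mathlib

section
/- Let f' and f be positive integers with f' ∣ f. If ζ ∈ F_{p^f} is a normal basis generator of F_{p^f} over F_p, then Tr_{F_{p^f}/F_{p^{f'}}}(ζ) is a normal basis generator of F_{p^{f'}} over F_p. (Consequently the trace maps carry the nonempty finite sets of normal basis generators into one another, making them a projective system.) -/
/-!
Fix a prime `p` and the algebraic closure of `𝔽_p`.  For each positive integer `f`,
`Fq p f` is the subfield `𝔽_{p^f} = {x | x ^ (p ^ f) = x}`, viewed as a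
`ZMod p`-submodule of the algebraic closure.  An element `ζ` is a normal basis
generator of `𝔽_{p^f}` over `𝔽_p` if its Frobenius orbit `(ζ, ζ^p, …, ζ^{p^{f-1}})`
is linearly independent over `𝔽_p` and spans `𝔽_{p^f}`.  For `f' ∣ f` the trace map
`Tr_{𝔽_{p^f}/𝔽_{p^{f'}}}` is `x ↦ ∑_{j < f/f'} x ^ (p ^ (f' * j))`.
-/

noncomputable section

/-- The subfield `𝔽_{p^f}` of the algebraic closure of `𝔽_p`, as a
`ZMod p`-submodule of the algebraic closure. -/
def Fq (p : ℕ) [Fact p.Prime] (f : ℕ) :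
    Submodule (ZMod p) (AlgebraicClosure (ZMod p)) where
  carrier := {x | x ^ p ^ f = x}
  add_mem' := by
    intro a b ha hb
    simp only [Set.mem_setOf_eq] at *
    rw [add_pow_char_pow, ha, hb]
  zero_mem' := by
    simp only [Set.mem_setOf_eq]
    exact zero_pow (pow_ne_zero _ (Fact.out (p := p.Prime)).ne_zero)
  smul_mem' := by
    intro c x hx
    simp only [Set.mem_setOf_eq] at *
    rw [Algebra.smul_def, mul_pow, hx, ← map_pow, ZMod.pow_card_pow]

/-- `ζ` is a normal basis generator of `𝔽_{p^f}` over `𝔽_p`:  the Frobenius orbit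
`(ζ, ζ^p, ζ^{p^2}, …, ζ^{p^{f-1}})` is an `𝔽_p`-basis of `𝔽_{p^f}`. -/
def IsNormalBasisGenerator (p : ℕ) [Fact p.Prime] (f : ℕ)
    (ζ : AlgebraicClosure (ZMod p)) : Prop :=
  LinearIndependent (ZMod p) (fun i : Fin f => ζ ^ p ^ (i : ℕ)) ∧
    Submodule.span (ZMod p) (Set.range fun i : Fin f => ζ ^ p ^ (i : ℕ)) = Fq p f

/-- The trace map `Tr_{𝔽_{p^f}/𝔽_{p^{f'}}}`, `x ↦ ∑_{j=0}^{f/f'-1} x ^ (p ^ (f' * j))`. -/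
def fieldTrace (p : ℕ) [Fact p.Prime] (f f' : ℕ) (x : AlgebraicClosure (ZMod p)) :
    AlgebraicClosure (ZMod p) :=
  ∑ j ∈ Finset.range (f / f'), x ^ p ^ (f' * j)

/-- The set of solutions of `x ^ p ^ n = x` has at most `p ^ n` elements. -/
theorem finite_Fq_and_ncard_le (p : ℕ) [Fact p.Prime] {n : ℕ} (hn : 0 < n) :
    (Fq p n : Set (AlgebraicClosure (ZMod p))).Finite ∧
      (Fq p n : Set (AlgebraicClosure (ZMod p))).ncard ≤ p ^ n := by
  classical
  have hp : 1 < p := (Fact.out : p.Prime).one_lt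
  set P : Polynomial (AlgebraicClosure (ZMod p)) := Polynomial.X ^ p ^ n - Polynomial.X with hP
  have hP0 : P ≠ 0 := FiniteField.X_pow_card_pow_sub_X_ne_zero _ hn.ne' hp
  have hdeg : P.natDegree = p ^ n := FiniteField.X_pow_card_pow_sub_X_natDegree_eq _ hn.ne' hp
  have hset : (Fq p n : Set (AlgebraicClosure (ZMod p))) = (P.roots.toFinset : Set _) := by
    ext x
    simp [Fq, hP0]
    simp [hP, sub_eq_zero]
  rw [hset]
  refine ⟨Finset.finite_toSet _, ?_⟩
  rw [Set.ncard_coe_finset, ← hdeg]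
  exact (Multiset.toFinset_card_le _).trans (Polynomial.card_roots' _)

theorem pow_mem_Fq {p : ℕ} [Fact p.Prime] {n : ℕ} {x : AlgebraicClosure (ZMod p)}
    (hx : x ∈ Fq p n) (k : ℕ) : x ^ k ∈ Fq p n := by
  change (x ^ k) ^ p ^ n = x ^ k
  rw [pow_right_comm, show x ^ p ^ n = x from hx]

/-- A linearly independent family of `n` elements of `𝔽_{p^n}` spans it. -/
theorem span_eq_Fq_of_linearIndependent {p : ℕ} [Fact p.Prime] {n : ℕ} (hn : 0 < n)
    {v : Fin n → AlgebraicClosure (ZMod p)} (hv : LinearIndependent (ZMod p) v)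
    (hmem : ∀ i, v i ∈ Fq p n) : Submodule.span (ZMod p) (Set.range v) = Fq p n := by
  have hle : Submodule.span (ZMod p) (Set.range v) ≤ Fq p n := by
    rw [Submodule.span_le]
    rintro _ ⟨i, rfl⟩
    exact hmem i
  obtain ⟨hfin, hcard⟩ := finite_Fq_and_ncard_le p hn
  apply SetLike.coe_injective
  refine Set.eq_of_subset_of_ncard_le hle (hcard.trans ?_) hfin
  have h : Nat.card (Submodule.span (ZMod p) (Set.range v)) = p ^ n := by
    have : Module.Finite (ZMod p) (Submodule.span (ZMod p) (Set.range v)) :=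
      Module.Finite.span_of_finite _ (Set.finite_range v)
    rw [Module.natCard_eq_pow_finrank (K := ZMod p), finrank_span_eq_card hv]
    simp
  exact h.ge

theorem fieldTrace_pow (p : ℕ) [Fact p.Prime] (f f' i : ℕ) (x : AlgebraicClosure (ZMod p)) :
    fieldTrace p f f' x ^ p ^ i = ∑ j ∈ Finset.range (f / f'), x ^ p ^ (i + f' * j) := by
  rw [fieldTrace, sum_pow_char_pow]
  refine Finset.sum_congr rfl fun j _ => ?_
  rw [← pow_mul, ← pow_add, add_comm]

theorem fieldTrace_mem_Fq {p : ℕ} [Fact p.Prime] {f f' : ℕ} (hdvd : f' ∣ f)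
    {x : AlgebraicClosure (ZMod p)} (hx : x ∈ Fq p f) : fieldTrace p f f' x ∈ Fq p f' := by
  change fieldTrace p f f' x ^ p ^ f' = fieldTrace p f f' x
  have h := Finset.sum_range_succ (fun j => x ^ p ^ (f' * j)) (f / f')
  rw [Finset.sum_range_succ', Nat.mul_div_cancel' hdvd, show x ^ p ^ f = x from hx] at h
  rw [fieldTrace_pow, fieldTrace]
  simpa [mul_add, add_comm] using h

/-- If `f' ∣ f` and `ζ` is a normal basis generator of `𝔽_{p^f}` over `𝔽_p`, then
`Tr_{𝔽_{p^f}/𝔽_{p^{f'}}}(ζ)` is a normal basis generator of `𝔽_{p^{f'}}` over `𝔽_p`. -/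
theorem isNormalBasisGenerator_fieldTrace (p : ℕ) [Fact p.Prime] (f' f : ℕ)
    (hf' : 0 < f') (hf : 0 < f) (hdvd : f' ∣ f) (ζ : AlgebraicClosure (ZMod p))
    (hζ : IsNormalBasisGenerator p f ζ) :
    IsNormalBasisGenerator p f' (fieldTrace p f f' ζ) := by
  obtain ⟨m, rfl⟩ := hdvd
  obtain ⟨hli, hspan⟩ := hζ
  have hζmem : ζ ∈ Fq p (f' * m) := by
    rw [← hspan]
    exact Submodule.subset_span ⟨⟨0, hf⟩, by simp⟩
  have hli' : LinearIndependent (ZMod p)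
      (fun i : Fin f' => fieldTrace p (f' * m) f' ζ ^ p ^ (i : ℕ)) := by
    have hprod : LinearIndependent (ZMod p)
        (fun a : Fin m × Fin f' => ζ ^ p ^ ((a.2 : ℕ) + f' * a.1)) :=
      hli.comp (fun a => Fin.cast (mul_comm m f') (finProdFinEquiv a))
        ((Fin.cast_injective _).comp finProdFinEquiv.injective)
    rw [Fintype.linearIndependent_iff] at hprod ⊢
    intro c hc i
    have hm : 0 < m := Nat.pos_of_mul_pos_left hf
    refine hprod (fun a => c a.2) ?_ (⟨0, hm⟩, i)
    rw [Fintype.sum_prod_type_right, ← hc]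
    refine Finset.sum_congr rfl fun k _ => ?_
    rw [fieldTrace_pow, Nat.mul_div_cancel_left m hf', Finset.sum_range, Finset.smul_sum]
  exact ⟨hli', span_eq_Fq_of_linearIndependent hf' hli' fun i =>
    pow_mem_Fq (fieldTrace_mem_Fq (dvd_mul_right f' m) hζmem) _⟩
end
end

section
/- Let M be a finitely generated 𝓡-module with pd_𝓡(M) ≤ 1 such that N = E¹(M) = Ext¹_𝓡(M, 𝓡) is pseudo-null and such that M has generic rank one over 𝓡 (i.e., M ⊗_𝓡 Q(𝓡) is a free Q(𝓡)-module of rank one). Then the dual module M* = Hom_𝓡(M, 𝓡) is a free 𝓡-module of rank one. -/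
noncomputable section

/-- The duality hypothesis: `Hom_Λ(𝓡, Λ) ≅ 𝓡` as `𝓡`-modules, where the `𝓡`-module
structure on `Hom_Λ(𝓡, Λ)` is `(r • φ)(x) = φ (r * x)`. -/
def SelfDualAlgebra (Λ 𝓡 : Type) [CommRing Λ] [CommRing 𝓡] [Algebra Λ 𝓡] : Prop :=
  ∃ e : (𝓡 →ₗ[Λ] Λ) ≃ₗ[Λ] 𝓡,
    ∀ (r : 𝓡) (φ : 𝓡 →ₗ[Λ] Λ),
      e (φ.comp (LinearMap.mulLeft Λ r)) = r * e φ

/-- `Λ` is a regular local ring: its maximal ideal is generated by `dim Λ` elements. -/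
def IsRegularLocal (Λ : Type) [CommRing Λ] [IsLocalRing Λ] : Prop :=
  ∃ s : Finset Λ, Ideal.span (s : Set Λ) = IsLocalRing.maximalIdeal Λ ∧
    (s.card : WithBot (WithTop ℕ)) = ringKrullDim Λ

/-- A prime ideal `q` has height at most one: there is no chain of primes
`q₀ < q₁ < q`. -/
def HeightLEOne (Λ : Type) [CommRing Λ] (q : Ideal Λ) : Prop :=
  ¬ ∃ q₀ q₁ : Ideal Λ, q₀.IsPrime ∧ q₁.IsPrime ∧ q₀ < q₁ ∧ q₁ < q

/-- An `𝓡`-module `N` is pseudo-null over `Λ`: for every prime `q` of `Λ` of height at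
most one, the localization `N_q` vanishes, i.e. every element of `N` is annihilated by
some `s ∉ q`. -/
def IsPseudoNull (Λ : Type) [CommRing Λ] {𝓡 : Type} [CommRing 𝓡] [Algebra Λ 𝓡]
    (N : Type) [AddCommGroup N] [Module 𝓡 N] : Prop :=
  ∀ q : Ideal Λ, q.IsPrime → HeightLEOne Λ q →
    ∀ x : N, ∃ s : Λ, s ∉ q ∧ algebraMap Λ 𝓡 s • x = 0

/-- A finitely generated module has projective dimension at most one: some (equivalently,
any) surjection from a finite free module has projective kernel. -/
def ProjDimLEOne (𝓡 : Type) [CommRing 𝓡] (M : Type) [AddCommGroup M] [Module 𝓡 M] :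
    Prop :=
  ∃ (n : ℕ) (φ : (Fin n → 𝓡) →ₗ[𝓡] M),
    Function.Surjective φ ∧ Module.Projective 𝓡 (LinearMap.ker φ)

abbrev ExtGrp (R : Type) [CommRing R] (M : Type) [AddCommGroup M] [Module R M] (i : ℕ) :
    ModuleCat R :=
  ((_root_.Ext R (ModuleCat R) i).obj (Opposite.op (ModuleCat.of R M))).obj (ModuleCat.of R R)

/-- `M` has generic rank one over `𝓡`: `M ⊗_𝓡 Q(𝓡)` is a free module of rank one over
the total ring of fractions `Q(𝓡)`. -/
def GenericRankOne (𝓡 : Type) [CommRing 𝓡] (M : Type) [AddCommGroup M] [Module 𝓡 M] :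
    Prop :=
  Nonempty (LocalizedModule (nonZeroDivisors 𝓡) M ≃ₗ[Localization (nonZeroDivisors 𝓡)]
    Localization (nonZeroDivisors 𝓡))

section RegularPair

open IsLocalRing

/-- Prime avoidance, with the square of the maximal ideal allowed among the ideals to avoid. -/
theorem IsLocalRing.exists_mem_maximalIdeal_notMem_sq {R : Type*} [CommRing R] [IsLocalRing R]
    [IsNoetherianRing R] (hm : maximalIdeal R ≠ ⊥) {S : Set (Ideal R)} (hS : S.Finite)
    (hprime : ∀ p ∈ S, p.IsPrime) (hmax : maximalIdeal R ∉ S) :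
    ∃ x ∈ maximalIdeal R, x ∉ maximalIdeal R ^ 2 ∧ ∀ p ∈ S, x ∉ p := by
  by_contra! h
  have hsub : (maximalIdeal R : Set R) ⊆ ⋃ p ∈ insert (maximalIdeal R ^ 2) S, (p : Set R) := by
    intro x hx
    by_cases hx2 : x ∈ maximalIdeal R ^ 2
    · exact Set.mem_biUnion (Set.mem_insert _ _) hx2
    · obtain ⟨p, hp, hxp⟩ := h x hx hx2
      exact Set.mem_biUnion (Set.mem_insert_of_mem _ hp) hxp
  obtain ⟨p, hp, hle⟩ := (Ideal.subset_union_prime_finite (f := id) (hS.insert _)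
    (maximalIdeal R ^ 2) (maximalIdeal R ^ 2)
    (fun i hi h1 _ => hprime i (hi.resolve_left h1))).1 hsub
  rcases hp with rfl | hp
  · refine hm (Submodule.eq_bot_of_le_smul_of_le_jacobson_bot (maximalIdeal R) _
      (IsNoetherian.noetherian _) ?_ (IsLocalRing.maximalIdeal_le_jacobson _))
    simpa [pow_two] using hle
  · have := hprime p hp
    exact hmax ((le_maximalIdeal this.ne_top).antisymm hle ▸ hp)

/-- A minimal generator of the maximal ideal can be exchanged into a generating set. -/
theorem IsLocalRing.exists_span_maximalIdeal_quotient {R : Type*} [CommRing R] [IsLocalRing R]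
    {n : ℕ} {s : Finset R} (hs : Ideal.span (s : Set R) = maximalIdeal R) (hcard : s.card ≤ n + 1)
    {x : R} (hx : x ∈ maximalIdeal R) (hx2 : x ∉ maximalIdeal R ^ 2)
    [IsLocalRing (R ⧸ Ideal.span {x})] :
    ∃ t : Finset (R ⧸ Ideal.span {x}), Ideal.span (t : Set (R ⧸ Ideal.span {x})) =
      maximalIdeal (R ⧸ Ideal.span {x}) ∧ t.card ≤ n := by
  classical
  have hmem : ∀ i ∈ s, i ∈ maximalIdeal R := fun i hi => hs ▸ Ideal.subset_span hi
  obtain ⟨a, -, hax⟩ := Submodule.mem_span_finset.1 (hs.ge hx)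
  obtain ⟨i, hi, hai⟩ : ∃ i ∈ s, IsUnit (a i) := by
    by_contra! h
    refine hx2 (hax ▸ Ideal.sum_mem _ fun i hi => ?_)
    rw [pow_two]
    exact Ideal.mul_mem_mul ((mem_maximalIdeal _).2 (h i hi)) (hmem i hi)
  set f := Ideal.Quotient.mk (Ideal.span {x})
  refine ⟨(s.erase i).image f, ?_, Finset.card_image_le.trans ?_⟩
  · rw [← map_maximalIdeal_of_surjective f Ideal.Quotient.mk_surjective, ← hs, Ideal.map_span]
    refine le_antisymm (Ideal.span_mono ?_) (Ideal.span_le.2 ?_)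
    · rw [Finset.coe_image]
      exact Set.image_mono (Finset.coe_subset.2 (Finset.erase_subset _ _))
    · rintro _ ⟨j, hj, rfl⟩
      have hne : ∀ j ∈ s.erase i, f j ∈
          Ideal.span (((s.erase i).image f : Finset _) : Set (R ⧸ Ideal.span {x})) :=
        fun j hj => Ideal.subset_span (Finset.mem_coe.2 (Finset.mem_image_of_mem f hj))
      by_cases hji : j = i
      · subst hji
        have h0 : f (a j) * f j + ∑ k ∈ s.erase j, f (a k) * f k = 0 := by
          rw [Finset.add_sum_erase s (fun k => f (a k) * f k) hi]
          have hfx : f x = 0 := Ideal.Quotient.eq_zero_iff_mem.2 (Ideal.mem_span_singleton_self x)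
          simpa [← hax, map_sum] using hfx
        refine (Ideal.unit_mul_mem_iff_mem _ (hai.map f)).1 ?_
        rw [eq_neg_of_add_eq_zero_left h0]
        exact neg_mem (Ideal.sum_mem _ fun k hk => Ideal.mul_mem_left _ _ (hne k hk))
      · exact hne j (Finset.mem_erase.2 ⟨hji, hj⟩)
  · rw [Finset.card_erase_of_mem hi]
    omega

theorem IsLocalRing.le_ringKrullDim_quotient {R : Type*} [CommRing R] [IsLocalRing R]
    [IsNoetherianRing R] {n : ℕ} (hn : ((n + 1 : ℕ) : WithBot ℕ∞) ≤ ringKrullDim R)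
    {x : R} (hx : x ∈ maximalIdeal R) :
    (n : WithBot ℕ∞) ≤ ringKrullDim (R ⧸ Ideal.span {x}) := by
  have h := Ideal.height_le_ringKrullDim_quotient_add_one hx
  rw [maximalIdeal_height_eq_ringKrullDim] at h
  have h2 := hn.trans h
  by_contra! hlt
  have h3 := ENat.WithBot.add_one_le_natCast_iff.2 hlt
  have h4 := h2.trans h3
  norm_cast at h4
  omega

theorem IsLocalRing.isLocalRing_quotient_span_singleton {R : Type*} [CommRing R] [IsLocalRing R]
    {x : R} (hx : x ∈ maximalIdeal R) : IsLocalRing (R ⧸ Ideal.span {x}) := by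
  have : Nontrivial (R ⧸ Ideal.span {x}) := Ideal.Quotient.nontrivial_iff.2 fun h =>
    (mem_maximalIdeal _).1 hx (Ideal.span_singleton_eq_top.1 h)
  exact IsLocalRing.of_surjective' (Ideal.Quotient.mk _) Ideal.Quotient.mk_surjective

theorem IsLocalRing.maximalIdeal_ne_bot_of_le_ringKrullDim {R : Type*} [CommRing R]
    [IsLocalRing R] {n : ℕ} (hn : ((n + 1 : ℕ) : WithBot ℕ∞) ≤ ringKrullDim R) :
    maximalIdeal R ≠ ⊥ := by
  intro h
  rw [← maximalIdeal_height_eq_ringKrullDim, h, Ideal.height_bot] at hn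
  norm_cast at hn

/-- A regular local ring is a domain. -/
theorem IsLocalRing.isDomain_of_span_maximalIdeal (n : ℕ) : ∀ {R : Type*} [CommRing R]
    [IsLocalRing R] [IsNoetherianRing R] {s : Finset R},
    Ideal.span (s : Set R) = maximalIdeal R → s.card ≤ n → (n : WithBot ℕ∞) ≤ ringKrullDim R →
    IsDomain R := by
  induction n with
  | zero =>
    intro R _ _ _ s hs hcard _
    rw [Finset.card_eq_zero.1 (Nat.le_zero.1 hcard), Finset.coe_empty, Ideal.span_empty] at hs
    exact (isField_iff_maximalIdeal_eq.2 hs.symm).isDomain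
  | succ n ih =>
    intro R _ _ _ s hs hcard hn
    have hm := maximalIdeal_ne_bot_of_le_ringKrullDim hn
    obtain ⟨x, hx, hx2, hxp⟩ := exists_mem_maximalIdeal_notMem_sq hm
      (minimalPrimes.finite_of_isNoetherianRing R) (fun p hp => hp.1.1) (fun h => by
        have h0 := Ideal.height_eq_zero_iff.2 h
        rw [← maximalIdeal_height_eq_ringKrullDim, h0] at hn
        norm_cast at hn)
    have := isLocalRing_quotient_span_singleton hx
    obtain ⟨t, ht, htn⟩ := exists_span_maximalIdeal_quotient hs hcard hx hx2
    have hdom := ih ht htn (le_ringKrullDim_quotient hn hx)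
    have hprime : (Ideal.span {x}).IsPrime := (Ideal.Quotient.isDomain_iff_prime _).1 hdom
    obtain ⟨q, hq, hqx⟩ := Ideal.exists_minimalPrimes_le (bot_le : ⊥ ≤ Ideal.span {x})
    have hqp : q.IsPrime := hq.1.1
    have hq0 : q = ⊥ := by
      refine Submodule.eq_bot_of_le_smul_of_le_jacobson_bot (maximalIdeal R) _
        (IsNoetherian.noetherian _) (fun y hy => ?_) (IsLocalRing.maximalIdeal_le_jacobson _)
      obtain ⟨z, rfl⟩ := Ideal.mem_span_singleton.1 (hqx hy)
      exact Ideal.mul_mem_mul hx ((hqp.mem_or_mem hy).resolve_left (hxp q hq))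
    have : (⊥ : Ideal R).IsPrime := hq0 ▸ hqp
    exact IsDomain.of_bot_isPrime R


theorem Ideal.mem_associatedPrimes_quotient_span_singleton_iff {R : Type*} [CommRing R]
    [IsNoetherianRing R] {a : R} {p : Ideal R} :
    p ∈ associatedPrimes R (R ⧸ Ideal.span {a}) ↔
      p.IsPrime ∧ ∃ c, ∀ r, r ∈ p ↔ a ∣ r * c := by
  rw [AssociatedPrimes.mem_iff, isAssociatedPrime_iff]
  refine and_congr_right fun _ => ?_
  have key : ∀ c r : R, r ∈ (⊥ : Submodule R (R ⧸ Ideal.span {a})).colon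
      {Ideal.Quotient.mk (Ideal.span {a}) c} ↔ a ∣ r * c := by
    intro c r
    rw [Submodule.mem_colon_singleton, Submodule.mem_bot, ← Ideal.mem_span_singleton,
      ← Ideal.Quotient.eq_zero_iff_mem, map_mul]
    rfl
  constructor
  · rintro ⟨y, rfl⟩
    obtain ⟨c, rfl⟩ := Ideal.Quotient.mk_surjective y
    exact ⟨c, key c⟩
  · rintro ⟨c, hc⟩
    exact ⟨Ideal.Quotient.mk _ c, Ideal.ext fun r => (hc r).trans (key c r).symm⟩

theorem Ideal.exists_mem_associatedPrimes_quotient_span_singleton {R : Type*} [CommRing R]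
    [IsNoetherianRing R] {a v : R} (hv : ¬ a ∣ v) :
    ∃ q ∈ associatedPrimes R (R ⧸ Ideal.span {a}), ∀ r, a ∣ r * v → r ∈ q := by
  obtain ⟨q, hq, hle⟩ := exists_le_isAssociatedPrime_of_isNoetherianRing R
    (Ideal.Quotient.mk (Ideal.span {a}) v)
    (fun h => hv (Ideal.mem_span_singleton.1 (Ideal.Quotient.eq_zero_iff_mem.1 h)))
  refine ⟨q, hq, fun r hr => hle ?_⟩
  rw [Submodule.mem_colon_singleton, Submodule.mem_bot]
  exact Ideal.Quotient.eq_zero_iff_mem.2 (Ideal.mem_span_singleton.2 hr)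

/-- An associated prime of a principal ideal that contains a prime element has height at most
one. -/
theorem Ideal.height_le_one_of_prime_mem {R : Type*} [CommRing R] [IsDomain R]
    [IsNoetherianRing R] {a c : R} {p : Ideal R} [p.IsPrime] (ha : a ≠ 0)
    (hp : ∀ r, r ∈ p ↔ a ∣ r * c) {x : R} (hx : Prime x) (hxp : x ∈ p) : p.height ≤ 1 := by
  obtain ⟨r, hr⟩ := (hp x).1 hxp
  have hxr : ¬ x ∣ r := by
    rintro ⟨s, rfl⟩
    refine (Ideal.ne_top_iff_one p).1 ‹p.IsPrime›.ne_top ((hp 1).2 ⟨s, ?_⟩)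
    exact mul_left_cancel₀ hx.ne_zero (by linear_combination hr)
  have hle : p ≤ Ideal.span {x} := by
    intro y hy
    obtain ⟨t, ht⟩ := (hp y).1 hy
    rw [Ideal.mem_span_singleton]
    refine (hx.dvd_or_dvd (b := r) ⟨t, ?_⟩).resolve_right hxr
    exact mul_left_cancel₀ ha (by linear_combination x * ht - y * hr)
  exact (Ideal.height_mono hle).trans (Ideal.height_span_singleton_le_one hx.not_isUnit)

/-- Over a regular local ring, the associated primes of a nonzero principal ideal have height at
most one. -/
theorem IsLocalRing.height_le_one_of_mem_associatedPrimes (n : ℕ) : ∀ {R : Type*} [CommRing R]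
    [IsLocalRing R] [IsNoetherianRing R] {s : Finset R},
    Ideal.span (s : Set R) = maximalIdeal R → s.card ≤ n → (n : WithBot ℕ∞) ≤ ringKrullDim R →
    ∀ {a : R}, a ≠ 0 → ∀ {p : Ideal R}, p ∈ associatedPrimes R (R ⧸ Ideal.span {a}) →
    p.height ≤ 1 := by
  induction n with
  | zero =>
    intro R _ _ _ s hs hcard _ a _ p hp
    rw [Finset.card_eq_zero.1 (Nat.le_zero.1 hcard), Finset.coe_empty, Ideal.span_empty] at hs
    refine (Ideal.height_mono (le_maximalIdeal hp.isPrime.ne_top)).trans ?_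
    rw [← hs, Ideal.height_bot]
    exact zero_le
  | succ n ih =>
    intro R _ _ _ s hs hcard hn a ha p hp
    have hdom := isDomain_of_span_maximalIdeal (n + 1) hs hcard hn
    have hm := maximalIdeal_ne_bot_of_le_ringKrullDim hn
    have hprime : ∀ x ∈ maximalIdeal R, x ∉ maximalIdeal R ^ 2 → Prime x := by
      intro x hx hx2
      have := isLocalRing_quotient_span_singleton hx
      obtain ⟨t, ht, htn⟩ := exists_span_maximalIdeal_quotient hs hcard hx hx2
      have := isDomain_of_span_maximalIdeal n ht htn (le_ringKrullDim_quotient hn hx)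
      exact (Ideal.span_singleton_prime (by rintro rfl; exact hx2 (zero_mem _))).1
        ((Ideal.Quotient.isDomain_iff_prime _).1 this)
    have hpp := hp.isPrime
    by_cases hpm : ∃ x ∈ p, x ∉ maximalIdeal R ^ 2
    · obtain ⟨x, hxp, hx2⟩ := hpm
      obtain ⟨-, c, hc⟩ := Ideal.mem_associatedPrimes_quotient_span_singleton_iff.1 hp
      exact Ideal.height_le_one_of_prime_mem ha hc
        (hprime x (le_maximalIdeal hpp.ne_top hxp) hx2) hxp
    push Not at hpm
    by_cases hmass : maximalIdeal R ∈ associatedPrimes R (R ⧸ Ideal.span {a})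
    · obtain ⟨x, hx, hx2, -⟩ := exists_mem_maximalIdeal_notMem_sq hm Set.finite_empty
        (by simp) (by simp)
      obtain ⟨-, c, hc⟩ := Ideal.mem_associatedPrimes_quotient_span_singleton_iff.1 hmass
      exact (Ideal.height_mono (le_maximalIdeal hpp.ne_top)).trans
        (Ideal.height_le_one_of_prime_mem ha hc (hprime x hx hx2) hx)
    obtain ⟨x, hx, hx2, hxass⟩ := exists_mem_maximalIdeal_notMem_sq hm
      (associatedPrimes.finite R (R ⧸ Ideal.span {a})) (fun q hq => hq.isPrime) hmass
    have hxreg : ∀ w, a ∣ x * w → a ∣ w := by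
      intro w hw
      by_contra hw2
      obtain ⟨q, hq, hqw⟩ := Ideal.exists_mem_associatedPrimes_quotient_span_singleton hw2
      exact hxass q hq (hqw x hw)
    have hxp := hprime x hx hx2
    obtain ⟨-, c, hc⟩ := Ideal.mem_associatedPrimes_quotient_span_singleton_iff.1 hp
    obtain ⟨v, hv, hvx⟩ : ∃ v, (∀ r ∈ p, a ∣ r * v) ∧ v ∉ Ideal.span {a} ⊔ Ideal.span {x} := by
      by_contra! h
      let T : Ideal R := 
        { carrier := {v | ∀ r ∈ p, a ∣ r * v}
          add_mem' := fun h1 h2 r hr => by rw [mul_add]; exact dvd_add (h1 r hr) (h2 r hr)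
          zero_mem' := fun r _ => by simp
          smul_mem' := fun b v h1 r hr => by
            rw [smul_eq_mul, mul_left_comm]; exact (h1 r hr).mul_left b }
      have hT : T ≤ Ideal.span {a} := by
        refine Submodule.le_of_le_smul_of_le_jacobson_bot (I := maximalIdeal R)
          (IsNoetherian.noetherian _) (IsLocalRing.maximalIdeal_le_jacobson _) fun v hv => ?_
        obtain ⟨y, hy, z, hz, rfl⟩ := Submodule.mem_sup.1 (h v hv)
        obtain ⟨w, rfl⟩ := Ideal.mem_span_singleton.1 hz
        refine Submodule.add_mem_sup hy (Ideal.mul_mem_mul hx fun r hr => hxreg _ ?_)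
        have h1 := hv r hr
        rw [mul_add, mul_left_comm r x w] at h1
        exact (dvd_add_right ((Ideal.mem_span_singleton.1 hy).mul_left r)).1 h1
      have hcT : c ∈ T := fun r hr => (hc r).1 hr
      refine (Ideal.ne_top_iff_one p).1 hpp.ne_top ((hc 1).2 ?_)
      rw [one_mul]
      exact Ideal.mem_span_singleton.1 (hT hcT)
    have := isLocalRing_quotient_span_singleton hx
    obtain ⟨t, ht, htn⟩ := exists_span_maximalIdeal_quotient hs hcard hx hx2
    set f := Ideal.Quotient.mk (Ideal.span {x}) with hf
    have hfdvd : ∀ y, f a ∣ f y ↔ y ∈ Ideal.span {a} ⊔ Ideal.span {x} := by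
      intro y
      rw [← Ideal.mem_quotient_iff_mem_sup, Ideal.map_span, Set.image_singleton,
        Ideal.mem_span_singleton]
    have hfa : f a ≠ 0 := by
      intro h0
      obtain ⟨a', rfl⟩ := Ideal.mem_span_singleton.1 (Ideal.Quotient.eq_zero_iff_mem.1 h0)
      obtain ⟨z, hz⟩ := hxreg a' dvd_rfl
      refine hxp.not_isUnit (IsUnit.of_mul_eq_one z ?_)
      exact mul_left_cancel₀ (right_ne_zero_of_mul ha) (by linear_combination -hz)
    obtain ⟨q, hq, hqv⟩ := Ideal.exists_mem_associatedPrimes_quotient_span_singleton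
      (mt (hfdvd v).1 hvx)
    have hqh := ih ht htn (le_ringKrullDim_quotient hn hx) hfa hq
    have hqp := hq.isPrime
    have hxq : x ∈ q.comap f := by
      rw [Ideal.mem_comap, Ideal.Quotient.eq_zero_iff_mem.2 (Ideal.mem_span_singleton_self x)]
      exact zero_mem q
    have hlt : p < q.comap f := by
      refine lt_of_le_of_ne (fun r hr => hqv _ ?_) fun h => hx2 (hpm x (h ▸ hxq))
      rw [← map_mul, hfdvd]
      exact Ideal.mem_sup_left (Ideal.mem_span_singleton.2 (hv r hr))
    have h1 := Ideal.height_add_one_le_of_lt_of_isPrime hlt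
    have h2 := Ideal.height_le_height_add_one_of_mem hxq
    rw [Ideal.map_comap_of_surjective _ Ideal.Quotient.mk_surjective] at h2
    exact ((ENat.add_le_add_iff_right (by simp)).1 (h1.trans h2)).trans hqh

/-- Over a regular local ring, an ideal that lies in no prime of height at most one contains a
regular sequence of length two. -/
theorem IsLocalRing.exists_regular_pair {R : Type*} [CommRing R]
    [IsLocalRing R] [IsNoetherianRing R] {s : Finset R}
    (hs : Ideal.span (s : Set R) = maximalIdeal R) (hcard : (s.card : WithBot ℕ∞) ≤ ringKrullDim R)
    {J : Ideal R} (hJ : ∀ q : Ideal R, q.IsPrime → q.height ≤ 1 → ¬ J ≤ q) :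
    IsDomain R ∧ ∃ a ∈ J, a ≠ 0 ∧ ∃ b ∈ J, ∀ c, a ∣ b * c → a ∣ c := by
  have hdom := isDomain_of_span_maximalIdeal _ hs le_rfl hcard
  have hJ0 : ¬ J ≤ ⊥ := hJ ⊥ Ideal.isPrime_bot (by rw [Ideal.height_bot]; exact zero_le)
  obtain ⟨a, haJ, ha⟩ := Set.not_subset.1 hJ0
  have ha : a ≠ 0 := ha
  refine ⟨hdom, a, haJ, ha, ?_⟩
  by_contra! h
  have hsub : (J : Set R) ⊆ ⋃ p ∈ associatedPrimes R (R ⧸ Ideal.span {a}), (p : Set R) := by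
    intro b hb
    obtain ⟨c, hbc, hc⟩ := h b hb
    obtain ⟨q, hq, hqc⟩ := Ideal.exists_mem_associatedPrimes_quotient_span_singleton hc
    exact Set.mem_biUnion hq (hqc b hbc)
  obtain ⟨q, hq, hle⟩ := (Ideal.subset_union_prime_finite (f := id)
    (associatedPrimes.finite R (R ⧸ Ideal.span {a})) ⊥ ⊥ fun q hq _ _ => hq.isPrime).1 hsub
  exact hJ q hq.isPrime (height_le_one_of_mem_associatedPrimes _ hs le_rfl hcard ha hq) hle

end RegularPair

section Minors

variable {R : Type*} [CommRing R] {m : ℕ}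

/-- The linear form `v ↦ det (A₁, …, Aₘ, v)` on `Rᵐ⁺¹`, for vectors `A₁, …, Aₘ` in `Rᵐ⁺¹`. -/
def maximalMinorForm (A : Fin m → Fin (m + 1) → R) : (Fin (m + 1) → R) →ₗ[R] R :=
  (Matrix.detRowAlternating (R := R) (n := Fin (m + 1))).toMultilinearMap.toLinearMap
    (Fin.snoc A 0) (Fin.last m)

theorem maximalMinorForm_apply (A : Fin m → Fin (m + 1) → R) (v : Fin (m + 1) → R) :
    maximalMinorForm A v = Matrix.det (Matrix.of (Fin.snoc A v : Fin (m + 1) → Fin (m + 1) → R)) := by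
  simp only [maximalMinorForm, MultilinearMap.toLinearMap_apply]
  rw [Fin.update_snoc_last]
  rfl

theorem maximalMinorForm_self (A : Fin m → Fin (m + 1) → R) (i : Fin m) :
    maximalMinorForm A (A i) = 0 := by
  rw [maximalMinorForm_apply]
  refine Matrix.det_zero_of_row_eq (Fin.castSucc_lt_last i).ne ?_
  exact (Fin.snoc_castSucc (α := fun _ => Fin (m + 1) → R) (A i) A i).trans
    (Fin.snoc_last (α := fun _ => Fin (m + 1) → R) (A i) A).symm

/-- A linear form vanishing on `A₁, …, Aₘ` is generically proportional to the form of maximal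
minors. -/
theorem maximalMinorForm_mul_comm (A : Fin m → Fin (m + 1) → R) (f : (Fin (m + 1) → R) →ₗ[R] R)
    (hf : ∀ i, f (A i) = 0) (u v : Fin (m + 1) → R) :
    f v * maximalMinorForm A u = f u * maximalMinorForm A v := by
  set X : Matrix (Fin (m + 1)) (Fin (m + 1)) R := Matrix.of (Fin.snoc A v) with hX
  set g : Fin (m + 1) → R := fun j => f (Pi.single j 1) with hg
  have hfg : ∀ w, f w = w ⬝ᵥ g := by
    intro w
    conv_lhs => rw [pi_eq_sum_univ' w, map_sum]
    simp [dotProduct, hg]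
  have hXg : X.mulVec g = Pi.single (Fin.last m) (f v) := by
    ext i
    refine Fin.lastCases ?_ (fun i => ?_) i
    · rw [Matrix.mulVec, Pi.single_eq_same, hfg v, hX]
      simp
    · rw [Matrix.mulVec, Pi.single_eq_of_ne (Fin.castSucc_lt_last i).ne, ← hf i, hfg (A i), hX]
      simp
  have hadj : ∀ j, X.det * g j = f v * maximalMinorForm A (Pi.single j 1) := by
    intro j
    have h1 : X.det • g = X.adjugate.mulVec (X.mulVec g) := by
      rw [Matrix.mulVec_mulVec, Matrix.adjugate_mul, Matrix.smul_mulVec, Matrix.one_mulVec]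
    have h2 := congrFun h1 j
    rw [hXg, Matrix.mulVec_single, Matrix.adjugate_def] at h2
    have h3 : X.updateRow (Fin.last m) (Pi.single j 1) =
        Matrix.of (Fin.snoc A (Pi.single j 1) : Fin (m + 1) → Fin (m + 1) → R) := by
      rw [hX]
      exact Fin.update_snoc_last (α := fun _ => Fin (m + 1) → R) v A (Pi.single j 1)
    simp [Matrix.cramer_transpose_apply, h3, ← maximalMinorForm_apply] at h2
    rw [h2, mul_comm]
  have hsum : ∀ h : (Fin (m + 1) → R) →ₗ[R] R, h u = ∑ j, u j * h (Pi.single j 1) := by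
    intro h
    conv_lhs => rw [pi_eq_sum_univ' u, map_sum]
    simp
  rw [hsum (maximalMinorForm A), hsum f, maximalMinorForm_apply A v, Finset.mul_sum,
    Finset.sum_mul]
  refine Finset.sum_congr rfl fun j _ => ?_
  linear_combination - u j * hadj j

theorem det_submatrix_mem_range_maximalMinorForm (A : Fin m → Fin (m + 1) → R)
    (σ : Fin m → Fin (m + 1)) :
    Matrix.det (Matrix.of fun i k => A k (σ i)) ∈ LinearMap.range (maximalMinorForm A) := by
  obtain ⟨j, hj⟩ : ∃ j, j ∉ Set.range σ := by
    by_contra! h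
    have := Fintype.card_le_of_surjective σ h
    simp at this
  set Y : Matrix (Fin (m + 1)) (Fin (m + 1)) R := Matrix.of (Fin.snoc A (Pi.single j 1)) with hY
  set τ : Fin (m + 1) → Fin (m + 1) := Fin.snoc σ j with hτ
  have h1 : Matrix.det (Y.submatrix id τ) = Matrix.det (Matrix.of fun i k => A k (σ i)) := by
    rw [Matrix.det_succ_row _ (Fin.last m), Finset.sum_eq_single (Fin.last m)]
    · have h0 : (Y.submatrix id τ).submatrix (Fin.last m).succAbove (Fin.last m).succAbove =
          (Matrix.of fun i k => A k (σ i)).transpose := by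
        ext a b
        simp [hY, hτ]
      rw [h0, Matrix.det_transpose]
      simp [hY, hτ]
    · intro b _ hb
      obtain ⟨b, rfl⟩ := Fin.exists_castSucc_eq.2 hb
      have : σ b ≠ j := fun h => hj ⟨b, h⟩
      simp [hY, hτ, Pi.single_eq_of_ne this]
    · simp
  rw [← h1]
  by_cases hinj : Function.Injective τ
  · set e := Equiv.ofBijective τ (Finite.injective_iff_bijective.1 hinj)
    have h2 : Matrix.det (Y.submatrix id τ) = Equiv.Perm.sign e * Y.det := Matrix.det_permute' e Y
    rw [h2, ← maximalMinorForm_apply]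
    exact ⟨((Equiv.Perm.sign e : ℤ) : R) • Pi.single j 1, by rw [map_smul, smul_eq_mul]⟩
  · obtain ⟨a, b, hab, hne⟩ := Function.not_injective_iff.1 hinj
    rw [Matrix.det_zero_of_column_eq hne (by simp [hab])]
    exact zero_mem _

/-- The determinant of a matrix `(hᵢ (Aₖ))` lies in the ideal of maximal minors of `A`. -/
theorem det_mem_range_maximalMinorForm (A : Fin m → Fin (m + 1) → R)
    (h : Fin m → (Fin (m + 1) → R) →ₗ[R] R) :
    Matrix.det (Matrix.of fun i k => h i (A k)) ∈ LinearMap.range (maximalMinorForm A) := by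
  have h1 : (fun i k => h i (A k)) =
      fun i => ∑ j, h i (Pi.single j 1) • fun k => A k j := by
    ext i k
    conv_lhs => rw [pi_eq_sum_univ' (A k), map_sum]
    simp [mul_comm]
  have h2 : Matrix.det (Matrix.of fun i k => h i (A k)) = Matrix.detRowAlternating
      (fun i => ∑ j, h i (Pi.single j 1) • fun k => A k j) := by
    rw [← h1]; rfl
  rw [h2, ← AlternatingMap.coe_multilinearMap, MultilinearMap.map_sum]
  refine Submodule.sum_mem _ fun σ _ => ?_
  rw [MultilinearMap.map_smul_univ]
  exact Submodule.smul_mem _ _ (det_submatrix_mem_range_maximalMinorForm A σ)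

/-- If the ideal of maximal minors of `A` contains a regular sequence of length two, then the
linear forms vanishing on `A₁, …, Aₘ` form a free module of rank one. -/
theorem existsUnique_eq_smul_maximalMinorForm (A : Fin m → Fin (m + 1) → R)
    {a b : R} (ha : a ∈ LinearMap.range (maximalMinorForm A))
    (hb : b ∈ LinearMap.range (maximalMinorForm A)) (hreg : ∀ c, a * c = 0 → c = 0)
    (hreg2 : ∀ c, a ∣ b * c → a ∣ c) (f : (Fin (m + 1) → R) →ₗ[R] R) (hf : ∀ i, f (A i) = 0) :
    ∃! c : R, c • maximalMinorForm A = f := by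
  obtain ⟨v, rfl⟩ := ha
  obtain ⟨w, rfl⟩ := hb
  have hcomm := maximalMinorForm_mul_comm A f hf
  obtain ⟨c, hc⟩ := hreg2 (f v) ⟨f w, by linear_combination hcomm w v⟩
  refine ⟨c, LinearMap.ext fun u => ?_, fun d hd => ?_⟩
  · refine sub_eq_zero.1 (hreg _ ?_)
    have := hcomm u v
    rw [LinearMap.smul_apply, smul_eq_mul]
    linear_combination this - maximalMinorForm A u * hc
  · refine sub_eq_zero.1 (hreg _ ?_)
    have := LinearMap.congr_fun hd v
    rw [LinearMap.smul_apply, smul_eq_mul] at this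
    linear_combination this + hc

end Minors

theorem Function.Exact.nonempty_equiv_prod_of_surjective {R K F N : Type*} [CommRing R]
    [AddCommGroup K] [AddCommGroup F] [AddCommGroup N] [Module R K] [Module R F] [Module R N]
    [Module.Projective R N] {f : K →ₗ[R] F} {g : F →ₗ[R] N} (hfg : Function.Exact f g)
    (hf : Function.Injective f) (hg : Function.Surjective g) : Nonempty (F ≃ₗ[R] K × N) := by
  obtain ⟨l, hl⟩ := Module.projective_lifting_property g LinearMap.id hg
  exact ⟨(hfg.splitSurjectiveEquiv hf ⟨l, hl⟩).1⟩

theorem finite_maximalSpectrum_of_finite (Λ R : Type*) [CommRing Λ] [IsLocalRing Λ] [CommRing R]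
    [Algebra Λ R] [Module.Finite Λ R] : Finite (MaximalSpectrum R) := by
  have h := Algebra.QuasiFinite.finite_primesOver (S := R) (IsLocalRing.maximalIdeal Λ)
  have : Finite ((IsLocalRing.maximalIdeal Λ).primesOver R) := h
  refine Finite.of_injective (β := (IsLocalRing.maximalIdeal Λ).primesOver R)
    (fun p => ⟨p.asIdeal, inferInstance, ⟨?_⟩⟩) ?_
  · have : (p.asIdeal.comap (algebraMap Λ R)).IsMaximal :=
      Ideal.isMaximal_comap_of_isIntegral_of_isMaximal p.asIdeal
    exact (IsLocalRing.eq_maximalIdeal this).symm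
  · intro p q h
    ext1
    exact congrArg Subtype.val h

theorem Function.Exact.nonempty_localizedModule_equiv_prod {R K F M : Type*} [CommRing R]
    (S : Submonoid R) [AddCommGroup K] [Module R K] [AddCommGroup F] [Module R F]
    [AddCommGroup M] [Module R M] {ι : K →ₗ[R] F} {φ : F →ₗ[R] M} (h : Function.Exact ι φ)
    (hι : Function.Injective ι) (hφ : Function.Surjective φ)
    (e : LocalizedModule S M ≃ₗ[Localization S] Localization S) :
    Nonempty (LocalizedModule S F ≃ₗ[Localization S] LocalizedModule S K × Localization S) := by
  let f := LocalizedModule.map S ι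
  let g := (e : LocalizedModule S M →ₗ[Localization S] Localization S) ∘ₗ LocalizedModule.map S φ
  have hf : Function.Injective f := LocalizedModule.map_injective S _ hι
  have hg : Function.Surjective g := e.surjective.comp (LocalizedModule.map_surjective S _ hφ)
  have hfg : Function.Exact f g := by
    intro x
    have h0 : g x = 0 ↔ LocalizedModule.map S φ x = 0 := by simp [g]
    exact h0.trans (LocalizedModule.map_exact S _ _ h x)
  exact hfg.nonempty_equiv_prod_of_surjective hf hg

open scoped TensorProduct in
/-- Over a semilocal ring, a projective kernel of a surjection `Rⁿ → M` onto a module of generic rank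
one is free of rank `n - 1`. -/
theorem LinearMap.exists_basis_ker_of_localizedModule_equiv {R M : Type*} [CommRing R]
    [Nontrivial R] [IsNoetherianRing R] [Finite (MaximalSpectrum R)] [AddCommGroup M] [Module R M]
    {n : ℕ} (φ : (Fin n → R) →ₗ[R] M) (hφ : Function.Surjective φ)
    [Module.Projective R (LinearMap.ker φ)]
    (e : LocalizedModule (nonZeroDivisors R) M ≃ₗ[Localization (nonZeroDivisors R)]
      Localization (nonZeroDivisors R)) :
    ∃ m, n = m + 1 ∧ Nonempty (Module.Basis (Fin m) R (LinearMap.ker φ)) := by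
  set S := nonZeroDivisors R
  let Q := Localization S
  obtain ⟨e'⟩ := (LinearMap.exact_subtype_ker_map φ).nonempty_localizedModule_equiv_prod S
    (Submodule.subtype_injective _) hφ e
  have key : ∀ p : PrimeSpectrum Q, Module.rankAtStalk (LinearMap.ker φ)
      (p.comap (algebraMap R Q)) + 1 = n := by
    intro p
    have h1 := congrFun (Module.rankAtStalk_eq_of_equiv e') p
    rw [Module.rankAtStalk_prod,
      Module.rankAtStalk_isBaseChange (LocalizedModule.isBaseChange S _)] at h1
    have : Nontrivial Q := p.nontrivial
    simp [Module.rankAtStalk_isBaseChange (LocalizedModule.isBaseChange S _)] at h1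
    exact h1.symm
  have hrank : ∀ p : PrimeSpectrum R, Module.rankAtStalk (LinearMap.ker φ) p + 1 = n := by
    intro p
    obtain ⟨q, hq, hqp⟩ := Ideal.exists_minimalPrimes_le (bot_le : ⊥ ≤ p.asIdeal)
    have := hq.1.1
    have hd : Disjoint (S : Set R) q :=
      (Ideal.disjoint_nonZeroDivisors_of_mem_minimalPrimes hq).symm
    obtain ⟨P, hP⟩ : (⟨q, this⟩ : PrimeSpectrum R) ∈
        Set.range (PrimeSpectrum.comap (algebraMap R Q)) := by
      rw [PrimeSpectrum.localization_comap_range Q S]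
      exact hd
    rw [← Module.rankAtStalk_eq_of_le_of_finite_of_flat (LinearMap.ker φ) (p := ⟨q, this⟩) hqp,
      ← hP]
    exact key P
  obtain ⟨p₀⟩ := (inferInstance : Nonempty (PrimeSpectrum R))
  refine ⟨Module.rankAtStalk (LinearMap.ker φ) p₀, (hrank p₀).symm,
    Module.nonempty_basis_of_flat_of_finrank_eq _ _ _ fun P => ?_⟩
  have : Module.rankAtStalk (LinearMap.ker φ) p₀ =
      Module.rankAtStalk (LinearMap.ker φ) P.toPrimeSpectrum := by
    have := hrank p₀
    have := hrank P.toPrimeSpectrum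
    omega
  rw [this]
  have : Module.Free (R ⧸ P.1) ((R ⧸ P.1) ⊗[R] LinearMap.ker φ) :=
    let : Field (R ⧸ P.1) := Ideal.Quotient.field P.1
    Module.Free.of_divisionRing _ _
  have h := Module.rankAtStalk_baseChange (R := R) (M := LinearMap.ker φ)
    (⟨⊥, Ideal.isPrime_bot⟩ : PrimeSpectrum (R ⧸ P.1))
  rw [Module.rankAtStalk_eq_finrank_of_free] at h
  refine h.trans (congrArg _ ?_)
  ext1
  exact Ideal.mk_ker

theorem CategoryTheory.ShortComplex.exists_eq_smul_of_homology {R : Type*} [CommRing R]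
    (S : CategoryTheory.ShortComplex (ModuleCat R)) {C : Set R}
    (hS : ∀ x : S.homology, ∃ s ∈ C, s • x = 0) (z : S.X₂) (hz : S.g z = 0) :
    ∃ s ∈ C, ∃ w : S.X₁, S.f w = s • z := by
  have hH : ∀ q : S.moduleCatLeftHomologyData.H, ∃ s ∈ C, s • q = 0 := by
    intro q
    obtain ⟨s, hs, h⟩ := hS (S.moduleCatHomologyIso.inv q)
    refine ⟨s, hs, ?_⟩
    have h' := congrArg S.moduleCatHomologyIso.hom h
    rwa [map_smul, CategoryTheory.Iso.inv_hom_id_apply, map_zero] at h'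
  let y : LinearMap.ker S.g.hom := ⟨z, hz⟩
  obtain ⟨s, hs, h⟩ := hH ((LinearMap.range S.moduleCatToCycles).mkQ y)
  have h' : (LinearMap.range S.moduleCatToCycles).mkQ (s • y) = 0 := h
  rw [Submodule.mkQ_apply, Submodule.Quotient.mk_eq_zero] at h'
  obtain ⟨w, hw⟩ := h'
  exact ⟨s, hs, w, congrArg Subtype.val hw⟩

theorem CategoryTheory.ProjectiveResolution.exists_comp_eq_smul {R : Type} [CommRing R]
    {M Y : ModuleCat R} (P : CategoryTheory.ProjectiveResolution M) {C : Set R}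
    (hC : ∀ x : ((_root_.Ext R (ModuleCat R) 1).obj (Opposite.op M)).obj Y, ∃ s ∈ C, s • x = 0)
    (z : P.complex.X 1 →ₗ[R] Y) (hz : z ∘ₗ (P.complex.d 2 1).hom = 0) :
    ∃ s ∈ C, ∃ w : P.complex.X 0 →ₗ[R] Y, w ∘ₗ (P.complex.d 1 0).hom = s • z := by
  let L := P.complex.linearYonedaObj R Y
  let e := P.isoExt (R := R) 1 Y ≪≫ L.homologyIsoSc' 0 1 2 (by simp) (by simp)
  have hL : ∀ x : (L.sc' 0 1 2).homology, ∃ s ∈ C, s • x = 0 := by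
    intro x
    obtain ⟨s, hs, h⟩ := hC (e.inv x)
    refine ⟨s, hs, ?_⟩
    have h' := congrArg e.hom h
    rwa [map_smul, CategoryTheory.Iso.inv_hom_id_apply, map_zero] at h'
  obtain ⟨s, hs, w, hw⟩ := (L.sc' 0 1 2).exists_eq_smul_of_homology hL (ModuleCat.ofHom z)
    (ModuleCat.hom_ext hz)
  exact ⟨s, hs, ModuleCat.Hom.hom w, congrArg ModuleCat.Hom.hom hw⟩

/-- If the first cohomology of `Hom(P, Y)` is torsion, where `P` is the start of a projective
resolution of `M`, then so is the cokernel of `Hom(F, Y) → Hom(ker φ, Y)` for a projective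
presentation `φ : F → M`. -/
theorem Function.Exact.exists_comp_subtype_ker_eq_smul {R M F Y P₀ P₁ P₂ : Type*} [CommRing R]
    [AddCommGroup M] [Module R M] [AddCommGroup F] [Module R F] [AddCommGroup Y] [Module R Y]
    [AddCommGroup P₀] [Module R P₀] [AddCommGroup P₁] [Module R P₁] [AddCommGroup P₂] [Module R P₂]
    [Module.Projective R F] [Module.Projective R P₀] {φ : F →ₗ[R] M}
    (hφ : Function.Surjective φ) [Module.Projective R (LinearMap.ker φ)] {d₂ : P₂ →ₗ[R] P₁}
    {d₁ : P₁ →ₗ[R] P₀} {ε : P₀ →ₗ[R] M} (hd : d₁ ∘ₗ d₂ = 0) (h₁ : Function.Exact d₁ ε)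
    (hε : Function.Surjective ε) {C : Set R}
    (hC : ∀ z : P₁ →ₗ[R] Y, z ∘ₗ d₂ = 0 → ∃ s ∈ C, ∃ w : P₀ →ₗ[R] Y, w ∘ₗ d₁ = s • z)
    (g : LinearMap.ker φ →ₗ[R] Y) :
    ∃ s ∈ C, ∃ h : F →ₗ[R] Y, ∀ x : LinearMap.ker φ, h x = s • g x := by
  obtain ⟨α₀, hα₀⟩ := Module.projective_lifting_property φ ε hφ
  obtain ⟨β₀, hβ₀⟩ := Module.projective_lifting_property ε φ hε
  have hα₀' := fun x => LinearMap.congr_fun hα₀ x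
  have hβ₀' := fun x => LinearMap.congr_fun hβ₀ x
  simp only [LinearMap.comp_apply] at hα₀' hβ₀'
  let α₁ : P₁ →ₗ[R] LinearMap.ker φ := (α₀ ∘ₗ d₁).codRestrict _ fun x => by
    simp [hα₀', h₁.apply_apply_eq_zero]
  let γ : LinearMap.ker φ →ₗ[R] LinearMap.ker ε :=
    (β₀ ∘ₗ (LinearMap.ker φ).subtype).codRestrict _ fun x => by simp [hβ₀']
  let δ : P₁ →ₗ[R] LinearMap.ker ε := d₁.codRestrict _ fun x => h₁.apply_apply_eq_zero x
  have hδ : Function.Surjective δ := by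
    rintro ⟨x, hx⟩
    obtain ⟨y, hy⟩ := (h₁ x).1 hx
    exact ⟨y, Subtype.ext hy⟩
  obtain ⟨β₁, hβ₁⟩ := Module.projective_lifting_property δ γ hδ
  have hβ₁' : ∀ x, d₁ (β₁ x) = β₀ x := fun x => congrArg Subtype.val (LinearMap.congr_fun hβ₁ x)
  let η : F →ₗ[R] LinearMap.ker φ := (α₀ ∘ₗ β₀ - LinearMap.id).codRestrict _ fun x => by
    simp [hα₀', hβ₀']
  have hη : ∀ x : LinearMap.ker φ, α₁ (β₁ x) = x + η x := by
    intro x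
    ext
    simp [α₁, η, hβ₁']
  obtain ⟨s, hs, w, hw⟩ := hC (g ∘ₗ α₁) (by
    ext x
    have : α₁ (d₂ x) = 0 := by
      ext
      have := LinearMap.congr_fun hd x
      simp only [LinearMap.comp_apply, LinearMap.zero_apply] at this
      simp [α₁, this]
    simp [this])
  refine ⟨s, hs, w ∘ₗ β₀ - s • (g ∘ₗ η), fun x => ?_⟩
  have := LinearMap.congr_fun hw (β₁ x)
  simp only [LinearMap.comp_apply, LinearMap.smul_apply, hη, hβ₁', map_add, smul_add] at this
  simp [this]

theorem exists_comp_subtype_ker_eq_smul_of_ext {R M F Y : Type} [CommRing R]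
    [AddCommGroup M] [Module R M] [AddCommGroup F] [Module R F] [AddCommGroup Y] [Module R Y]
    [Module.Projective R F] {φ : F →ₗ[R] M}
    (hφ : Function.Surjective φ) [Module.Projective R (LinearMap.ker φ)] {C : Set R}
    (hC : ∀ x : ((_root_.Ext R (ModuleCat R) 1).obj (Opposite.op (ModuleCat.of R M))).obj
      (ModuleCat.of R Y), ∃ s ∈ C, s • x = 0)
    (g : LinearMap.ker φ →ₗ[R] Y) :
    ∃ s ∈ C, ∃ h : F →ₗ[R] Y, ∀ x : LinearMap.ker φ, h x = s • g x := by
  let P := CategoryTheory.projectiveResolution (ModuleCat.of R M)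
  have : Module.Projective R (P.complex.X 0) :=
    (IsProjective.iff_projective (P.complex.X 0)).2 (P.projective 0)
  refine Function.Exact.exists_comp_subtype_ker_eq_smul hφ (d₂ := (P.complex.d 2 1).hom)
    (d₁ := (P.complex.d 1 0).hom) (ε := (P.π.f 0).hom) ?_ ?_ ?_
    (fun z hz => P.exists_comp_eq_smul hC z hz) g
  · rw [← ModuleCat.hom_comp, P.complex.d_comp_d]
    rfl
  · exact (CategoryTheory.ShortComplex.ShortExact.moduleCat_exact_iff_function_exact _).1 P.exact₀
  · exact (ModuleCat.epi_iff_surjective _).1 inferInstance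

theorem heightLEOne_of_height_le_one {Λ : Type} [CommRing Λ] {q : Ideal Λ} [q.IsPrime]
    (hq : q.height ≤ 1) : HeightLEOne Λ q := by
  rintro ⟨q₀, q₁, h₀, h₁, h01, h1q⟩
  have h2 := Ideal.height_add_one_le_of_lt_of_isPrime h1q
  have h3 := Ideal.height_add_one_le_of_lt_of_isPrime h01
  have h4 : q₀.height + 1 + 1 ≤ 0 + 1 := by
    rw [zero_add]
    exact (add_le_add_left h3 1).trans (h2.trans hq)
  have h5 : q₀.height + 1 ≤ 0 := (WithTop.add_le_add_iff_right ENat.one_ne_top).1 h4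
  simp at h5

theorem mul_eq_zero_of_free {Λ 𝓡 : Type*} [CommRing Λ] [IsDomain Λ] [CommRing 𝓡] [Algebra Λ 𝓡]
    [Module.Free Λ 𝓡] {a : Λ} (ha : a ≠ 0) (c : 𝓡) (h : algebraMap Λ 𝓡 a * c = 0) : c = 0 := by
  rw [← Algebra.smul_def] at h
  exact (smul_eq_zero.1 h).resolve_left ha

theorem algebraMap_dvd_of_free {Λ 𝓡 : Type*} [CommRing Λ] [CommRing 𝓡] [Algebra Λ 𝓡]
    [Module.Free Λ 𝓡] {a b : Λ} (hab : ∀ c, a ∣ b * c → a ∣ c) (c : 𝓡)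
    (h : algebraMap Λ 𝓡 a ∣ algebraMap Λ 𝓡 b * c) : algebraMap Λ 𝓡 a ∣ c := by
  let B := Module.Free.chooseBasis Λ 𝓡
  obtain ⟨d, hd⟩ := h
  simp only [← Algebra.smul_def] at hd
  have hc : ∀ i, a ∣ B.repr c i := fun i => hab _ ⟨B.repr d i, by
    simpa using congrArg (fun x => B.repr x i) hd⟩
  choose f hf using hc
  classical
  let g : Module.Free.ChooseBasisIndex Λ 𝓡 →₀ Λ :=
    Finsupp.onFinset (B.repr c).support (fun i => if B.repr c i = 0 then 0 else f i) (by
      intro i hi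
      rw [Finsupp.mem_support_iff]
      intro h0
      simp [h0] at hi)
  refine ⟨B.repr.symm g, ?_⟩
  rw [← Algebra.smul_def]
  apply B.repr.injective
  ext i
  rw [map_smul, LinearEquiv.apply_symm_apply, Finsupp.smul_apply]
  by_cases h0 : B.repr c i = 0
  · simp [g, h0]
  · simp [g, h0, ← hf i]

/-- If the relations of `M` form an `m × (m + 1)` matrix whose ideal of maximal minors contains a
regular sequence of length two, then the dual of `M` is free of rank one. -/
theorem nonempty_dual_equiv_of_basis_ker {R M : Type*} [CommRing R] [AddCommGroup M] [Module R M]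
    {m : ℕ} {φ : (Fin (m + 1) → R) →ₗ[R] M} (hφ : Function.Surjective φ)
    (B : Module.Basis (Fin m) R (LinearMap.ker φ)) {a b : R}
    (ha : a ∈ LinearMap.range (maximalMinorForm fun i => (B i : Fin (m + 1) → R)))
    (hb : b ∈ LinearMap.range (maximalMinorForm fun i => (B i : Fin (m + 1) → R)))
    (hreg : ∀ c, a * c = 0 → c = 0) (hreg2 : ∀ c, a ∣ b * c → a ∣ c) :
    Nonempty ((M →ₗ[R] R) ≃ₗ[R] R) := by
  set A : Fin m → Fin (m + 1) → R := fun i => (B i : Fin (m + 1) → R)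
  have hker : ∀ f : (Fin (m + 1) → R) →ₗ[R] R, (∀ i, f (A i) = 0) →
      LinearMap.ker φ ≤ LinearMap.ker f := by
    intro f hf x hx
    have : f ∘ₗ (LinearMap.ker φ).subtype = 0 := B.ext fun i => by simpa using hf i
    exact LinearMap.congr_fun this ⟨x, hx⟩
  obtain ⟨δ, hδ⟩ : ∃ δ : M →ₗ[R] R, δ ∘ₗ φ = maximalMinorForm A := by
    have := hker _ (maximalMinorForm_self A)
    refine ⟨(LinearMap.ker φ).liftQ _ this ∘ₗ
      (φ.quotKerEquivOfSurjective hφ).symm.toLinearMap, ?_⟩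
    refine LinearMap.ext fun x => ?_
    have hx : (φ.quotKerEquivOfSurjective hφ).symm (φ x) = Submodule.Quotient.mk x := by
      rw [LinearEquiv.symm_apply_eq]
      rfl
    simp [hx]
  refine ⟨(LinearEquiv.ofBijective (LinearMap.toSpanSingleton R (M →ₗ[R] R) δ) ⟨?_, ?_⟩).symm⟩
  · intro c d hcd
    have hu := existsUnique_eq_smul_maximalMinorForm A ha hb hreg hreg2
      (c • maximalMinorForm A) fun i => by simp [maximalMinorForm_self]
    refine hu.unique rfl ?_
    rw [← hδ, ← LinearMap.smul_comp, ← LinearMap.smul_comp]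
    exact congrArg (· ∘ₗ φ) hcd.symm
  · intro f
    obtain ⟨c, hc, -⟩ := existsUnique_eq_smul_maximalMinorForm A ha hb hreg hreg2 (f ∘ₗ φ)
      fun i => by
        rw [LinearMap.comp_apply, (B i).2, map_zero]
    refine ⟨c, ?_⟩
    rw [← hδ, ← LinearMap.smul_comp] at hc
    exact (LinearMap.cancel_right hφ).1 hc

theorem exists_prod_algebraMap_mem_range {Λ R M : Type*} [CommRing Λ] [CommRing R] [Algebra Λ R]
    [AddCommGroup M] [Module R M] {m : ℕ} {φ : (Fin (m + 1) → R) →ₗ[R] M}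
    (B : Module.Basis (Fin m) R (LinearMap.ker φ)) {q : Ideal Λ} [q.IsPrime]
    (h : ∀ g : LinearMap.ker φ →ₗ[R] R, ∃ s ∉ q, ∃ f : (Fin (m + 1) → R) →ₗ[R] R,
      ∀ x : LinearMap.ker φ, f x = algebraMap Λ R s * g x) :
    ∃ s ∉ q, algebraMap Λ R s ∈
      LinearMap.range (maximalMinorForm fun i => (B i : Fin (m + 1) → R)) := by
  choose s hs f hf using fun k => h (B.coord k)
  refine ⟨∏ k, s k, fun hmem => ?_, ?_⟩
  · obtain ⟨k, -, hk⟩ := (Ideal.IsPrime.prod_mem_iff).1 hmem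
    exact hs k hk
  · convert det_mem_range_maximalMinorForm (fun i => (B i : Fin (m + 1) → R)) f
    have : (Matrix.of fun i k => f i (B k : Fin (m + 1) → R)) =
        Matrix.diagonal fun k => algebraMap Λ R (s k) := by
      ext i k
      simp [hf, Matrix.diagonal_apply, Finsupp.single_apply, eq_comm]
    rw [this, Matrix.det_diagonal, map_prod]

/-- Let `Λ` be a commutative Noetherian regular local ring and `𝓡` a commutative
`Λ`-algebra, free of finite rank as a `Λ`-module, with `Hom_Λ(𝓡, Λ) ≅ 𝓡` as
`𝓡`-modules.  Let `M` be a finitely generated `𝓡`-module with `pd_𝓡(M) ≤ 1` such that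
`N = Ext¹_𝓡(M, 𝓡)` is pseudo-null and `M` has generic rank one over `𝓡`.  Then
`M* = Hom_𝓡(M, 𝓡)` is a free `𝓡`-module of rank one. -/
theorem dual_free_of_rank_one
    (Λ 𝓡 : Type) [CommRing Λ] [IsNoetherianRing Λ] [IsLocalRing Λ]
    (hreg : IsRegularLocal Λ)
    [CommRing 𝓡] [Algebra Λ 𝓡] [Module.Free Λ 𝓡] [Module.Finite Λ 𝓡]
    (hdual : SelfDualAlgebra Λ 𝓡)
    (M : Type) [AddCommGroup M] [Module 𝓡 M] [Module.Finite 𝓡 M]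
    (hpd : ProjDimLEOne 𝓡 M)
    (hPN : IsPseudoNull Λ (𝓡 := 𝓡) ↥(ExtGrp 𝓡 M 1))
    (hrk : GenericRankOne 𝓡 M) :
    Nonempty ((M →ₗ[𝓡] 𝓡) ≃ₗ[𝓡] 𝓡) := by
  cases subsingleton_or_nontrivial 𝓡 with
  | inl h =>
    have : Subsingleton M := Module.subsingleton 𝓡 M
    exact ⟨0⟩
  | inr h =>
    obtain ⟨n, φ, hφ, hproj⟩ := hpd
    obtain ⟨e⟩ := hrk
    have := finite_maximalSpectrum_of_finite Λ 𝓡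
    have : IsNoetherianRing 𝓡 := IsNoetherianRing.of_finite Λ 𝓡
    obtain ⟨m, rfl, ⟨B⟩⟩ := φ.exists_basis_ker_of_localizedModule_equiv hφ e
    let I : Ideal 𝓡 := LinearMap.range (maximalMinorForm fun i => (B i : Fin (m + 1) → 𝓡))
    have hI : ∀ q : Ideal Λ, q.IsPrime → q.height ≤ 1 → ¬ I.comap (algebraMap Λ 𝓡) ≤ q := by
      intro q hq hq1 hle
      obtain ⟨s, hs, hsI⟩ := exists_prod_algebraMap_mem_range B (q := q) fun g => by
        obtain ⟨_, ⟨s, hs, rfl⟩, f, hf⟩ := exists_comp_subtype_ker_eq_smul_of_ext hφ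
          (C := algebraMap Λ 𝓡 '' {s | s ∉ q}) (fun x => by
            obtain ⟨s, hs, hx⟩ := hPN q hq (heightLEOne_of_height_le_one hq1) x
            exact ⟨_, ⟨s, hs, rfl⟩, hx⟩) g
        exact ⟨s, hs, f, hf⟩
      exact hs (hle hsI)
    obtain ⟨s, hs, hcard⟩ := hreg
    obtain ⟨_, a, ha, ha0, b, hb, hab⟩ := IsLocalRing.exists_regular_pair hs hcard.le hI
    exact nonempty_dual_equiv_of_basis_ker hφ B ha hb (mul_eq_zero_of_free ha0)
      (algebraMap_dvd_of_free hab)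
end
end
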